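/- For all natural numbers N and ℓ: Σ_{k=0}^{N} [N,k]_{q²} · q^{(2ℓ+1)k} = (∏_{k=1}^{N}(1 + q^k)) · Σ_{s=0}^{ℓ} c_{ℓ|s} · q^{s(s+1)/2} · q^{N·s}, where the coefficients c_{ℓ|s} are given by: for s = 2r, c_{ℓ|2r} = [ℓ−r,r]_{q²} · ∏_{j=r}^{ℓ−r−1}(1 − q^{2j+1}); and for s = 2r+1, c_{ℓ|2r+1} = [ℓ−r−1,r]_{q²} · ∏_{j=r+1}^{ℓ−r−1}(1 − q^{2j+1}) (empty products equal 1). -/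

import Mathlib

/-- The Gaussian (`q`-binomial) coefficient `[n, k]_q`, defined by the recurrence
`[n, 0]_q = 1`, `[0, k+1]_q = 0`, `[n+1, k+1]_q = [n, k]_q + q^(k+1) * [n, k+1]_q`
(so that `[n+1, k]_q = [n, k-1]_q + q^k * [n, k]_q` and `[n, k]_q = 0` for `k > n`). -/
def qBinom {R : Type*} [CommRing R] (q : R) : ℕ → ℕ → R
  | _, 0 => 1
  | 0, _ + 1 => 0
  | n + 1, k + 1 => qBinom q n k + q ^ (k + 1) * qBinom q n (k + 1)

/-- The connection coefficients `c_{ℓ|s}` of (5.16):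
`c_{ℓ|2r} = [ℓ-r, r]_{q²} ⬝ ∏_{j=r}^{ℓ-r-1} (1 - q^{2j+1})` and
`c_{ℓ|2r+1} = [ℓ-r-1, r]_{q²} ⬝ ∏_{j=r+1}^{ℓ-r-1} (1 - q^{2j+1})`. -/
def carlitzCoeff {R : Type*} [CommRing R] (q : R) (ℓ s : ℕ) : R :=
  if s % 2 = 0 then
    qBinom (q ^ 2) (ℓ - s / 2) (s / 2) *
      ∏ j ∈ Finset.Ico (s / 2) (ℓ - s / 2), (1 - q ^ (2 * j + 1))
  else
    qBinom (q ^ 2) (ℓ - s / 2 - 1) (s / 2) *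
      ∏ j ∈ Finset.Ico (s / 2 + 1) (ℓ - s / 2), (1 - q ^ (2 * j + 1))

section qBinom

variable {R : Type*} [CommRing R]

@[simp]
theorem qBinom_zero_right (q : R) (n : ℕ) : qBinom q n 0 = 1 := by
  cases n <;> rfl

theorem qBinom_succ_succ (q : R) (n k : ℕ) :
    qBinom q (n + 1) (k + 1) = qBinom q n k + q ^ (k + 1) * qBinom q n (k + 1) := rfl

theorem qBinom_eq_zero_of_lt (q : R) {n k : ℕ} (h : n < k) : qBinom q n k = 0 := by
  induction n generalizing k with
  | zero =>
    obtain ⟨k, rfl⟩ := Nat.exists_eq_succ_of_ne_zero h.ne'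
    rfl
  | succ n ih =>
    obtain ⟨k, rfl⟩ := Nat.exists_eq_succ_of_ne_zero (Nat.ne_zero_of_lt h)
    rw [Nat.succ_eq_add_one, qBinom_succ_succ, ih (by omega), ih (by omega), mul_zero, add_zero]

@[simp]
theorem qBinom_self (q : R) (n : ℕ) : qBinom q n n = 1 := by
  induction n with
  | zero => rfl
  | succ n ih => rw [qBinom_succ_succ, ih, qBinom_eq_zero_of_lt q n.lt_succ_self, mul_zero, add_zero]

theorem one_sub_pow_mul_qBinom_succ_succ (q : R) (n k : ℕ) :
    (1 - q ^ (k + 1)) * qBinom q (n + 1) (k + 1) = (1 - q ^ (n + 1)) * qBinom q n k := by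
  induction n generalizing k with
  | zero =>
    cases k with
    | zero => simp
    | succ k => simp [qBinom_eq_zero_of_lt]
  | succ n ih =>
    rw [qBinom_succ_succ q (n + 1) k]
    cases k with
    | zero =>
      have h := ih 0
      simp only [qBinom_zero_right] at h ⊢
      linear_combination q * h
    | succ k =>
      linear_combination q ^ (k + 2) * ih (k + 1) + q * ih k
        - q * (1 - q ^ (n + 1)) * qBinom_succ_succ q n k

theorem pow_sub_pow_mul_qBinom_succ (q : R) (n k : ℕ) :
    (q ^ k - q ^ (n + 1)) * qBinom q (n + 1) k = q ^ k * (1 - q ^ (n + 1)) * qBinom q n k := by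
  cases k with
  | zero => simp
  | succ k =>
    linear_combination (1 - q ^ (n + 1)) * qBinom_succ_succ q n k
      - one_sub_pow_mul_qBinom_succ_succ q n k

end qBinom

section RogersSzego

variable {R : Type*} [CommRing R]

/-- The Rogers–Szegő polynomial `∑ k, [N, k]_q x ^ k`. -/
def rogersSzego (q : R) (N : ℕ) (x : R) : R :=
  ∑ k ∈ Finset.range (N + 1), qBinom q N k * x ^ k

theorem rogersSzego_succ (q : R) (N : ℕ) (x : R) :
    rogersSzego q (N + 1) x = x * rogersSzego q N x + rogersSzego q N (q * x) := by
  have h : rogersSzego q N (q * x) =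
      ∑ k ∈ Finset.range (N + 2), qBinom q N k * (q * x) ^ k := by
    rw [Finset.sum_range_succ, qBinom_eq_zero_of_lt q N.lt_succ_self, zero_mul, add_zero]
    rfl
  rw [h, rogersSzego, rogersSzego, Finset.sum_range_succ', Finset.sum_range_succ' _ (N + 1),
    Finset.mul_sum, ← add_assoc, ← Finset.sum_add_distrib]
  simp only [qBinom_zero_right, pow_zero]
  congr 1
  refine Finset.sum_congr rfl fun k _ => ?_
  rw [qBinom_succ_succ]
  ring

theorem rogersSzego_sub_rogersSzego_mul (q : R) (N : ℕ) (x : R) :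
    rogersSzego q (N + 1) x - rogersSzego q (N + 1) (q * x) =
      (1 - q ^ (N + 1)) * x * rogersSzego q N x := by
  rw [rogersSzego, rogersSzego, ← Finset.sum_sub_distrib, Finset.sum_range_succ', rogersSzego,
    Finset.mul_sum]
  simp only [pow_zero, sub_self, add_zero]
  refine Finset.sum_congr rfl fun k _ => ?_
  linear_combination x ^ (k + 1) * one_sub_pow_mul_qBinom_succ_succ q N k

theorem rogersSzego_sq_self (q : R) (N : ℕ) :
    rogersSzego (q ^ 2) N q = ∏ k ∈ Finset.range N, (1 + q ^ (k + 1)) := by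
  induction N using Nat.twoStepInduction with
  | zero => simp [rogersSzego]
  | one => simp [rogersSzego, Finset.sum_range_succ]
  | more N ih₀ ih₁ =>
    have h := rogersSzego_sub_rogersSzego_mul (q ^ 2) N q
    rw [ih₀, ih₁, Finset.prod_range_succ] at h
    rw [rogersSzego_succ, ih₁, Finset.prod_range_succ _ (N + 1), Finset.prod_range_succ _ N]
    linear_combination -h

end RogersSzego

section carlitzCoeff

variable {R : Type*} [CommRing R]

theorem carlitzCoeff_two_mul (q : R) (ℓ r : ℕ) :
    carlitzCoeff q ℓ (2 * r) = qBinom (q ^ 2) (ℓ - r) r *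
      ∏ j ∈ Finset.Ico r (ℓ - r), (1 - q ^ (2 * j + 1)) := by
  simp [carlitzCoeff]

theorem carlitzCoeff_two_mul_add_one (q : R) (ℓ r : ℕ) :
    carlitzCoeff q ℓ (2 * r + 1) = qBinom (q ^ 2) (ℓ - r - 1) r *
      ∏ j ∈ Finset.Ico (r + 1) (ℓ - r), (1 - q ^ (2 * j + 1)) := by
  have h : (2 * r + 1) / 2 = r := by omega
  simp [carlitzCoeff, h]

theorem carlitzCoeff_self (q : R) (ℓ : ℕ) : carlitzCoeff q ℓ ℓ = 1 := by
  obtain ⟨r, rfl | rfl⟩ := Nat.even_or_odd' ℓ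
  · rw [carlitzCoeff_two_mul, show 2 * r - r = r by omega]
    simp
  · rw [carlitzCoeff_two_mul_add_one, show 2 * r + 1 - r = r + 1 by omega]
    simp

theorem carlitzCoeff_succ_zero (q : R) (ℓ : ℕ) :
    carlitzCoeff q (ℓ + 1) 0 = (1 - q ^ (2 * ℓ + 1)) * carlitzCoeff q ℓ 0 := by
  simp [carlitzCoeff, Finset.prod_range_succ, mul_comm]

theorem carlitzCoeff_succ_succ (q : R) {ℓ s : ℕ} (h : s < ℓ) :
    carlitzCoeff q (ℓ + 1) (s + 1) =
      (q ^ (s + 1) - q ^ (2 * ℓ + 1)) * carlitzCoeff q ℓ (s + 1) + carlitzCoeff q ℓ s := by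
  obtain ⟨r, rfl | rfl⟩ := Nat.even_or_odd' s
  · obtain ⟨m, rfl⟩ : ∃ m, ℓ = m + r + 1 := ⟨ℓ - r - 1, by omega⟩
    rw [carlitzCoeff_two_mul_add_one, carlitzCoeff_two_mul_add_one, carlitzCoeff_two_mul,
      show m + r + 1 + 1 - r = m + 1 + 1 by omega, show m + r + 1 - r = m + 1 by omega,
      Nat.add_sub_cancel, Nat.add_sub_cancel,
      Finset.prod_Ico_succ_top (show r + 1 ≤ m + 1 by omega),
      Finset.prod_eq_prod_Ico_succ_bot (show r < m + 1 by omega)]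
    linear_combination q * (∏ j ∈ Finset.Ico (r + 1) (m + 1), (1 - q ^ (2 * j + 1))) *
      pow_sub_pow_mul_qBinom_succ (q ^ 2) m r
  · obtain ⟨m, rfl⟩ : ∃ m, ℓ = m + r + 1 := ⟨ℓ - r - 1, by omega⟩
    rw [show 2 * r + 1 + 1 = 2 * (r + 1) by ring, carlitzCoeff_two_mul, carlitzCoeff_two_mul,
      carlitzCoeff_two_mul_add_one, show m + r + 1 + 1 - (r + 1) = m + 1 by omega,
      show m + r + 1 - (r + 1) = m by omega, show m + r + 1 - r = m + 1 by omega,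
      Nat.add_sub_cancel, Finset.prod_Ico_succ_top (show r + 1 ≤ m by omega), qBinom_succ_succ]
    ring

/-- The polynomial `∑ s, c_{ℓ|s} q ^ (s (s + 1) / 2) y ^ s`. -/
def carlitzPoly (q : R) (ℓ : ℕ) (y : R) : R :=
  ∑ s ∈ Finset.range (ℓ + 1), carlitzCoeff q ℓ s * q ^ (s * (s + 1) / 2) * y ^ s

theorem carlitzPoly_succ (q : R) (ℓ : ℕ) (y : R) :
    carlitzPoly q (ℓ + 1) y =
      (1 + q * y) * carlitzPoly q ℓ (q * y) - q ^ (2 * ℓ + 1) * carlitzPoly q ℓ y := by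
  have htri (s : ℕ) : (s + 1) * (s + 1 + 1) / 2 = s * (s + 1) / 2 + (s + 1) := by
    rw [show (s + 1) * (s + 1 + 1) = s * (s + 1) + 2 * (s + 1) by ring]
    omega
  have hsplit : (1 + q * y) * carlitzPoly q ℓ (q * y) - q ^ (2 * ℓ + 1) * carlitzPoly q ℓ y =
      ∑ s ∈ Finset.range (ℓ + 1),
        (q ^ s - q ^ (2 * ℓ + 1)) * carlitzCoeff q ℓ s * q ^ (s * (s + 1) / 2) * y ^ s +
      ∑ s ∈ Finset.range (ℓ + 1),
        carlitzCoeff q ℓ s * q ^ ((s + 1) * (s + 1 + 1) / 2) * y ^ (s + 1) := by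
    simp only [carlitzPoly, Finset.mul_sum, ← Finset.sum_add_distrib, ← Finset.sum_sub_distrib]
    refine Finset.sum_congr rfl fun s _ => ?_
    rw [htri]
    ring
  rw [hsplit, Finset.sum_range_succ', Finset.sum_range_succ _ ℓ, carlitzPoly,
    Finset.sum_range_succ', Finset.sum_range_succ, carlitzCoeff_self, carlitzCoeff_self,
    carlitzCoeff_succ_zero]
  have hsum : ∑ s ∈ Finset.range ℓ, carlitzCoeff q (ℓ + 1) (s + 1) *
        q ^ ((s + 1) * (s + 1 + 1) / 2) * y ^ (s + 1) =
      ∑ s ∈ Finset.range ℓ, (q ^ (s + 1) - q ^ (2 * ℓ + 1)) * carlitzCoeff q ℓ (s + 1) *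
        q ^ ((s + 1) * (s + 1 + 1) / 2) * y ^ (s + 1) +
      ∑ s ∈ Finset.range ℓ,
        carlitzCoeff q ℓ s * q ^ ((s + 1) * (s + 1 + 1) / 2) * y ^ (s + 1) := by
    rw [← Finset.sum_add_distrib]
    refine Finset.sum_congr rfl fun s hs => ?_
    rw [carlitzCoeff_succ_succ q (Finset.mem_range.mp hs)]
    ring
  rw [hsum]
  ring

theorem rogersSzego_sq_odd_pow (q : R) (N ℓ : ℕ) :
    rogersSzego (q ^ 2) N (q ^ (2 * ℓ + 1)) =
      (∏ k ∈ Finset.range N, (1 + q ^ (k + 1))) * carlitzPoly q ℓ (q ^ N) := by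
  induction ℓ generalizing N with
  | zero => simp [rogersSzego_sq_self, carlitzPoly, carlitzCoeff_self]
  | succ ℓ ih =>
    have h := rogersSzego_succ (q ^ 2) N (q ^ (2 * ℓ + 1))
    rw [ih, ih, Finset.prod_range_succ, ← pow_add, pow_succ' q N] at h
    rw [carlitzPoly_succ, show 2 * (ℓ + 1) + 1 = 2 + (2 * ℓ + 1) by ring]
    linear_combination -h

end carlitzCoeff

/-- Formulae (5.12), (5.16):
`∑_{k=0}^{N} [N,k]_{q²} q^{(2ℓ+1)k} = σ_N(1) ∑_{s=0}^{ℓ} c_{ℓ|s} q^{\binom{s+1}{2}} (q^N)^s`,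
where `σ_N(1) = (1+q)(1+q²)⋯(1+q^N)`. -/
theorem carlitz_sigma_formula {R : Type*} [CommRing R] (q : R) (N ℓ : ℕ) :
    ∑ k ∈ Finset.range (N + 1), qBinom (q ^ 2) N k * q ^ ((2 * ℓ + 1) * k) =
      (∏ k ∈ Finset.range N, (1 + q ^ (k + 1))) *
        ∑ s ∈ Finset.range (ℓ + 1),
          carlitzCoeff q ℓ s * q ^ (s * (s + 1) / 2) * (q ^ N) ^ s := by
  simpa only [rogersSzego, carlitzPoly, ← pow_mul] using rogersSzego_sq_odd_pow q N ℓ
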